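/- Let μ be the Borel probability measure on 𝒮 which is the law of the inhomogeneous Markov chain with μ(S_0 = 0) = μ(S_1 = 1) = 1 and, for every N ≥ 1 and s ∈ {1,…,N}, μ(S_{N+1} = s | S_N = s) = N/(N+1) and μ(S_{N+1} = N+1 | S_N = s) = 1/(N+1). Then μ(S_N → ∞ as N → ∞) = 1, and nevertheless μ has trivial tail. -/

import Mathlib

open MeasureTheory Filter
open scoped ENNReal NNReal

namespace VMCPaper

abbrev Path : Type := ℕ → ℕ

def staircaseSet : Set Path :=
  {S | (∀ N, S N ≤ N) ∧ ∀ N, S (N + 1) = S N ∨ S (N + 1) = N + 1}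

noncomputable def pr {α : Type*} [MeasurableSpace α] (μ : Measure α) (A : Set α) : ℝ :=
  (μ A).toReal

def IsSMC (μ : Measure Path) : Prop :=
  IsProbabilityMeasure μ ∧ μ staircaseSet = 1 ∧
  ∀ (N : ℕ) (a : ℕ → ℕ),
    0 < pr μ {S | ∀ i ≤ N, S i = a i} →
    pr μ {S | (∀ i ≤ N, S i = a i) ∧ S (N + 1) = a (N + 1)} /
        pr μ {S | ∀ i ≤ N, S i = a i}
      = pr μ {S | S N = a N ∧ S (N + 1) = a (N + 1)} / pr μ {S | S N = a N}

noncomputable def marginals (μ : Measure Path) : ℕ → ℕ → ℝ :=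
  fun N a => pr μ {S | S N = a}

def D : Set (ℕ → ℕ → ℝ) :=
  {ν | (∀ N a, 0 ≤ ν N a) ∧ (∀ N a, N < a → ν N a = 0) ∧
       (∀ N, ∑ a ∈ Finset.range (N + 1), ν N a = 1) ∧
       ∀ N a, a ≤ N → ν (N + 1) a ≤ ν N a}

def PMC : Set (ProbabilityMeasure Path) := {μ | IsSMC (μ : Measure Path)}

def IsBalayage (π : ℕ → ℕ → ℝ) : Prop :=
  (∀ N a, 0 ≤ π N a) ∧ (∀ N a, N < a → π N a = 0) ∧
  ∀ N, ∑ a ∈ Finset.range (N + 1), π N a = 1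

def Dpi (π : ℕ → ℕ → ℝ) : Set (ℕ → ℕ → ℝ) :=
  {ν | ν ∈ D ∧ ∀ N a, a ≤ N → ν N a = ν (N + 1) a + ν (N + 1) (N + 1) * π N a}

def PMCpi (π : ℕ → ℕ → ℝ) : Set (Measure Path) :=
  {μ | IsSMC μ ∧ ∀ N a, a ≤ N →
    0 < pr μ {S | S (N + 1) = N + 1} →
    pr μ {S | S N = a ∧ S (N + 1) = N + 1} / pr μ {S | S (N + 1) = N + 1} = π N a}

def pathTail : MeasurableSpace Path :=
  ⨅ N : ℕ, MeasurableSpace.comap (fun (S : Path) (i : ℕ) => S (N + i)) inferInstance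

def HasTrivialTail (μ : Measure Path) : Prop :=
  ∀ A : Set Path, MeasurableSet[pathTail] A → μ A = 0 ∨ μ A = 1

def AffineOn {E : Type*} [AddCommMonoid E] [Module ℝ E] (f : E → ℝ) (K : Set E) : Prop :=
  ∀ x ∈ K, ∀ y ∈ K, ∀ t : ℝ, 0 ≤ t → t ≤ 1 →
    f (t • x + (1 - t) • y) = t * f x + (1 - t) * f y

def RepresentsOn {E : Type*} [AddCommMonoid E] [Module ℝ E] [TopologicalSpace E]
    [MeasurableSpace E] (m : Measure E) (K : Set E) (x : E) : Prop :=
  ∀ f : E → ℝ, ContinuousOn f K → AffineOn f K → f x = ∫ y, f y ∂m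

def IsChoquetSimplex {E : Type*} [AddCommMonoid E] [Module ℝ E] [TopologicalSpace E]
    [MeasurableSpace E] (K : Set E) : Prop :=
  ∀ x ∈ K, ∃! m : Measure E,
    IsProbabilityMeasure m ∧ m (Set.extremePoints ℝ K) = 1 ∧ RepresentsOn m K x

noncomputable def hitTime (x : Path) (A : Set ℕ) : ℕ → ℕ∞
  | 0 => ⨅ i ∈ {i : ℕ | x i ∈ A}, (i : ℕ∞)
  | k + 1 => ⨅ i ∈ {i : ℕ | hitTime x A k < (i : ℕ∞) ∧ x i ∈ A}, (i : ℕ∞)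

noncomputable def proj (N : ℕ) (x : Path) : Path := fun i =>
  if hitTime x {a | a ≤ N} i = ⊤ then 0 else x (hitTime x {a | a ≤ N} i).toNat

def pathSpace (N : ℕ) : Set Path :=
  {x | (∀ i, x i ≤ N) ∧ ∀ i, x i = 0 → ∀ j, i ≤ j → x j = 0}

def fullPathSpace : Set Path := {x | ∀ i, x i = 0 → ∀ j, i ≤ j → x j = 0}

def IsMarkovChain {Ω : Type*} [MeasurableSpace Ω] (P : Measure Ω) (Y : ℕ → Ω → ℕ) : Prop :=
  (∀ i, Measurable (Y i)) ∧
  (∀ (n : ℕ) (b : ℕ → ℕ),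
    0 < (P {ω | ∀ i ≤ n, Y i ω = b i}).toReal →
    (P {ω | (∀ i ≤ n, Y i ω = b i) ∧ Y (n + 1) ω = b (n + 1)}).toReal /
        (P {ω | ∀ i ≤ n, Y i ω = b i}).toReal
      = (P {ω | Y n ω = b n ∧ Y (n + 1) ω = b (n + 1)}).toReal /
        (P {ω | Y n ω = b n}).toReal) ∧
  (∀ m n b c : ℕ,
    0 < (P {ω | Y m ω = b}).toReal → 0 < (P {ω | Y n ω = b}).toReal →
    (P {ω | Y m ω = b ∧ Y (m + 1) ω = c}).toReal / (P {ω | Y m ω = b}).toReal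
      = (P {ω | Y n ω = b ∧ Y (n + 1) ω = c}).toReal / (P {ω | Y n ω = b}).toReal)

def IsVMC {Ω : Type*} [MeasurableSpace Ω] (P : Measure Ω) (X : Ω → ℕ → Path) : Prop :=
  IsProbabilityMeasure P ∧
  Measurable X ∧
  (∀ ω N, X ω N ∈ pathSpace N) ∧
  (∀ ω N, proj N (X ω (N + 1)) = X ω N) ∧
  ∀ N, IsMarkovChain P (fun i ω => X ω N i)

def S0 {Ω : Type*} (X : Ω → ℕ → Path) (N : ℕ) (ω : Ω) : ℕ := X ω N 0

noncomputable def Vis {Ω : Type*} (X : Ω → ℕ → Path) (a : ℕ) (ω : Ω) : ℕ∞ :=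
  {k : ℕ | hitTime (X ω a) {a} k ≠ ⊤}.encard

open scoped Classical in
noncomputable def Sak {Ω : Type*} (X : Ω → ℕ → Path) (a k N : ℕ) (ω : Ω) : ℕ :=
  if (k : ℕ∞) < Vis X a ω ∧ hitTime (X ω N) {a} k ≠ ⊤ then
    X ω N ((hitTime (X ω N) {a} k).toNat + 1)
  else 0

def InfinitelyVisited {Ω : Type*} [MeasurableSpace Ω] (P : Measure Ω)
    (X : Ω → ℕ → Path) (a : ℕ) : Prop := P {ω | Vis X a ω = ⊤} = 1

def OnceVisited {Ω : Type*} [MeasurableSpace Ω] (P : Measure Ω)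
    (X : Ω → ℕ → Path) (a : ℕ) : Prop := P {ω | Vis X a ω = 1} = 1

def NeverVisited {Ω : Type*} [MeasurableSpace Ω] (P : Measure Ω)
    (X : Ω → ℕ → Path) (a : ℕ) : Prop := P {ω | Vis X a ω = 0} = 1

def RandomlyVisited {Ω : Type*} [MeasurableSpace Ω] (P : Measure Ω)
    (X : Ω → ℕ → Path) (a : ℕ) : Prop :=
  ¬ InfinitelyVisited P X a ∧ ¬ OnceVisited P X a ∧ ¬ NeverVisited P X a

def sigmaX {Ω : Type*} (X : Ω → ℕ → Path) : MeasurableSpace Ω :=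
  MeasurableSpace.comap X inferInstance

def tailVMC {Ω : Type*} (X : Ω → ℕ → Path) : MeasurableSpace Ω :=
  ⨅ N : ℕ, MeasurableSpace.comap (fun ω (M : ℕ) => X ω (N + M)) inferInstance

def TailTrivial {Ω : Type*} [MeasurableSpace Ω] (P : Measure Ω) (X : Ω → ℕ → Path) : Prop :=
  ∀ A : Set Ω, MeasurableSet[tailVMC X] A → P A = 0 ∨ P A = 1

def RepresentedBy {Ω : Type*} [MeasurableSpace Ω] (P : Measure Ω) (X : Ω → ℕ → Path)
    (ν : ℕ → ℕ → ℝ) (K : ℕ → ℕ → ℕ → ℝ) : Prop :=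
  (∀ N a, a ≤ N → (P {ω | X ω N 0 = a}).toReal = ν N a) ∧
  ∀ N a b, a ≤ N → b ≤ N → 0 < (P {ω | X ω N 0 = a}).toReal →
    (P {ω | X ω N 0 = a ∧ X ω N 1 = b}).toReal / (P {ω | X ω N 0 = a}).toReal = K N a b

noncomputable def piK (K : ℕ → ℕ → ℕ → ℝ) (N : ℕ) (b : ℕ) : ℝ :=
  if K (N + 1) (N + 1) (N + 1) < 1 then
    K (N + 1) (N + 1) b / (1 - K (N + 1) (N + 1) (N + 1))
  else if b = 0 then 1 else 0

def IsVTM (K : ℕ → ℕ → ℕ → ℝ) : Prop :=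
  (∀ N a b, 0 ≤ K N a b) ∧
  (∀ N a b, a ≤ N → N < b → K N a b = 0) ∧
  (∀ N a, a ≤ N → ∑ b ∈ Finset.range (N + 1), K N a b = 1) ∧
  (∀ N, K N 0 0 = 1) ∧
  (∀ N a b, a ≤ N → b ≤ N → K N a b = K (N + 1) a b + K (N + 1) a (N + 1) * piK K N b)

def mpow (N : ℕ) (M : ℕ → ℕ → ℝ) : ℕ → ℕ → ℕ → ℝ
  | 0 => fun a b => if a = b then 1 else 0
  | n + 1 => fun a b => ∑ c ∈ Finset.range (N + 1), mpow N M n a c * M c b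

def IsIrreducibleVTM (K : ℕ → ℕ → ℕ → ℝ) : Prop :=
  ∀ N, 1 ≤ N → ∀ a b, 1 ≤ a → a ≤ N → 1 ≤ b → b ≤ N →
    ∃ n, 0 < mpow N (K N) n a b

def IsClassical {Ω : Type*} [MeasurableSpace Ω] (P : Measure Ω) (X : Ω → ℕ → Path) : Prop :=
  ∀ᵐ ω ∂P, ∃ x : Path, x ∈ fullPathSpace ∧
    (∀ i, ∀ᶠ N in atTop, X ω N i = x i) ∧ ∀ N, X ω N = proj N x


def jmp (n : ℕ) : Set Path := {S | S (n + 1) = n + 1}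

open scoped Classical in
noncomputable def rec0 (M : ℕ) (S : Path) : Path
  | 0 => 0
  | N + 1 => if M ≤ N ∧ S ∈ jmp N then N + 1 else rec0 M S N

open scoped Classical in
theorem coalesce (X Y : Path) (P : ℕ → Prop) (n : ℕ)
    (hX : ∀ N ≥ n, X (N + 1) = if P N then N + 1 else X N)
    (hY : ∀ N ≥ n, Y (N + 1) = if P N then N + 1 else Y N) (hn : P n) :
    ∀ N ≥ n + 1, X N = Y N := by
  intro N hN
  induction N, hN using Nat.le_induction with
  | base => rw [hX n le_rfl, hY n le_rfl, if_pos hn, if_pos hn]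
  | succ k hk ih => rw [hX k (by omega), hY k (by omega), ih]

theorem tail_congr (A : Set Path) (hA : MeasurableSet[pathTail] A) (X Y : Path) (n : ℕ)
    (h : ∀ N ≥ n, X N = Y N) : X ∈ A ↔ Y ∈ A := by
  unfold pathTail at hA
  rw [MeasurableSpace.measurableSet_iInf] at hA
  obtain ⟨B, -, rfl⟩ := hA n
  have : (fun i => X (n + i)) = fun i => Y (n + i) := by
    funext i; exact h _ (by omega)
  simp only [Set.mem_preimage, this]

theorem tail_meas (A : Set Path) (hA : MeasurableSet[pathTail] A) : MeasurableSet A := by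
  unfold pathTail at hA
  rw [MeasurableSpace.measurableSet_iInf] at hA
  obtain ⟨B, hB, rfl⟩ := hA 0
  exact (measurable_pi_lambda _ fun i => measurable_pi_apply _) hB

theorem jmp_meas (n : ℕ) : MeasurableSet (jmp n) :=
  measurableSet_eq_fun (measurable_pi_apply (n + 1)) measurable_const

def sg (n : ℕ) : MeasurableSpace Path := MeasurableSpace.generateFrom {jmp n}

theorem sg_jmp (n : ℕ) : MeasurableSet[sg n] (jmp n) :=
  MeasurableSpace.measurableSet_generateFrom rfl

def inf0 : Set Path := {S | ∀ k, ∃ n ≥ k, S ∈ jmp n}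

theorem stair_rec (S : Path) (hS : S ∈ staircaseSet) (N : ℕ) [Decidable (S ∈ jmp N)] :
    S (N + 1) = if S ∈ jmp N then N + 1 else S N := by
  split_ifs with h
  · exact h
  · exact (hS.2 N).resolve_right h

theorem rec0_meas (M : ℕ) : @Measurable _ _ (⨆ n ≥ M, sg n) _ (rec0 M) := by
  refine @measurable_pi_lambda _ _ _ (_) _ _ fun N => ?_
  induction N with
  | zero => exact @measurable_const _ _ _ (_) _
  | succ N ih =>
    classical
    by_cases h : M ≤ N
    · have : (fun S => rec0 M S (N + 1)) = fun S => if S ∈ jmp N then N + 1 else rec0 M S N := by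
        funext S; simp [rec0, h]
      rw [this]
      refine @Measurable.ite _ _ (_) _ _ _ _ _ ?_ (@measurable_const _ _ _ (_) _) ih
      exact (le_iSup₂_of_le (f := fun n (_ : n ≥ M) => sg n) N h le_rfl) _ (sg_jmp N)
    · have : (fun S => rec0 M S (N + 1)) = fun S => rec0 M S N := by
        funext S; simp [rec0, h]
      rw [this]; exact ih

theorem inf0_meas (M : ℕ) : MeasurableSet[⨆ n ≥ M, sg n] inf0 := by
  have : inf0 = ⋂ k : ℕ, ⋃ n : ℕ, ⋃ _ : k ≤ n ∧ M ≤ n, jmp n := by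
    ext S
    simp only [inf0, Set.mem_ofPred_eq, Set.mem_iInter, Set.mem_iUnion, exists_prop]
    constructor
    · intro h k
      obtain ⟨n, hn, h⟩ := h (max k M)
      exact ⟨n, ⟨by omega, by omega⟩, h⟩
    · intro h k
      obtain ⟨n, hn, h⟩ := h k
      exact ⟨n, hn.1, h⟩
  rw [this]
  refine MeasurableSet.iInter fun k => MeasurableSet.iUnion fun n => MeasurableSet.iUnion fun h => ?_
  exact (le_iSup₂_of_le (f := fun n (_ : n ≥ M) => sg n) n h.2 le_rfl) _ (sg_jmp n)

theorem tail_eq (A : Set Path) (hA : MeasurableSet[pathTail] A) (M : ℕ) :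
    rec0 0 ⁻¹' A ∩ inf0 = rec0 M ⁻¹' A ∩ inf0 := by
  classical
  ext S
  simp only [Set.mem_inter_iff, Set.mem_preimage, and_congr_left_iff]
  intro h
  obtain ⟨n, hn, h⟩ := h M
  refine tail_congr A hA _ _ (n + 1) (coalesce _ _ (fun N => S ∈ jmp N) n ?_ ?_ h)
  · intro N hN; simp [rec0]
  · intro N hN; simp [rec0, hn.le.trans hN]

theorem tail_eq2 (A : Set Path) (hA : MeasurableSet[pathTail] A) (S : Path)
    (hS : S ∈ staircaseSet) (hI : S ∈ inf0) : S ∈ rec0 0 ⁻¹' A ∩ inf0 ↔ S ∈ A := by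
  classical
  simp only [Set.mem_inter_iff, Set.mem_preimage, hI, and_true]
  obtain ⟨n, hn, h⟩ := hI 0
  refine tail_congr A hA _ _ (n + 1) (coalesce _ _ (fun N => S ∈ jmp N) n ?_ ?_ h)
  · intro N hN; simp [rec0]
  · intro N hN; exact stair_rec S hS N

theorem tail_limsup (A : Set Path) (hA : MeasurableSet[pathTail] A) :
    MeasurableSet[limsup sg atTop] (rec0 0 ⁻¹' A ∩ inf0) := by
  rw [limsup_eq_iInf_iSup_of_nat, MeasurableSpace.measurableSet_iInf]
  intro M
  rw [tail_eq A hA M]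
  exact @MeasurableSet.inter _ (_) _ _ (rec0_meas M (tail_meas A hA)) (inf0_meas M)

theorem stair_tendsto (S : Path) (hS : S ∈ staircaseSet) (hI : S ∈ inf0) :
    Tendsto S atTop atTop := by
  have hm : Monotone S := monotone_nat_of_le_succ fun n => by
    have := hS.1 n
    rcases hS.2 n with h | h <;> omega
  refine tendsto_atTop_atTop_of_monotone hm fun b => ?_
  obtain ⟨n, hn, h⟩ := hI b
  exact ⟨n + 1, by rw [show S (n + 1) = n + 1 from h]; omega⟩

theorem stair_meas : MeasurableSet staircaseSet := by
  unfold staircaseSet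
  have h : ∀ n, Measurable fun S : Path => S n := fun n => measurable_pi_apply n
  simp only [measurableSet_setOfPred]
  refine Measurable.and (Measurable.forall fun N => ?_) (Measurable.forall fun N => Measurable.or ?_ ?_)
  · exact measurableSet_setOfPred.1 (measurableSet_le (h N) measurable_const)
  · exact measurableSet_setOfPred.1 (measurableSet_eq_fun (h _) (h _))
  · exact measurableSet_setOfPred.1 (measurableSet_eq_fun (h _) measurable_const)

def rst (N : ℕ) (S : Path) (i : {i // i ≤ N}) : ℕ := S i

section
variable {μ : Measure Path}

theorem cyl_step (hSMC : IsSMC μ) (h1 : pr μ {S | S 1 = 1} = 1)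
    (htrans : ∀ N s : ℕ, 1 ≤ N → 1 ≤ s → s ≤ N → 0 < pr μ {S | S N = s} →
      pr μ {S | S N = s ∧ S (N + 1) = s} / pr μ {S | S N = s}
          = (N : ℝ) / ((N : ℝ) + 1) ∧
      pr μ {S | S N = s ∧ S (N + 1) = N + 1} / pr μ {S | S N = s}
          = 1 / ((N : ℝ) + 1)) (N : ℕ) (a : ℕ → ℕ) :
    pr μ ({S | ∀ i ≤ N, S i = a i} ∩ jmp N) =
      1 / ((N : ℝ) + 1) * pr μ {S | ∀ i ≤ N, S i = a i} := by
  obtain ⟨hp, hst, hM⟩ := hSMC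
  have hae : ∀ᵐ S ∂μ, S ∈ staircaseSet := by
    rw [← prob_compl_eq_zero_iff stair_meas] at hst
    exact hst
  have hae1 : ∀ᵐ S ∂μ, S 1 = 1 := by
    have : μ (jmp 0) = 1 := by
      have h2 : μ {S | S 1 = 1} = 1 := by simpa [pr, ENNReal.toReal_eq_one_iff] using h1
      exact h2
    rw [← prob_compl_eq_zero_iff (jmp_meas 0)] at this
    exact this
  rcases Nat.eq_zero_or_pos N with rfl | hN
  · simp only [pr, Nat.cast_zero, zero_add, div_one, one_mul]
    congr 1
    apply measure_congr
    rw [eventuallyEq_set]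
    filter_upwards [hae1] with S hS
    simp [jmp, hS]
  have hnn : 0 ≤ pr μ {S | ∀ i ≤ N, S i = a i} := ENNReal.toReal_nonneg
  rcases hnn.eq_or_lt with h0 | hpos
  · rw [← h0, mul_zero]
    apply le_antisymm _ ENNReal.toReal_nonneg
    rw [h0]
    exact ENNReal.toReal_mono (measure_ne_top _ _) (measure_mono Set.inter_subset_left)
  have hpos2 : 0 < pr μ {S | S N = a N} := hpos.trans_le <|
    ENNReal.toReal_mono (measure_ne_top _ _) (measure_mono fun S hS => hS N le_rfl)
  have hge : ∀ S ∈ staircaseSet, S 1 = 1 → ∀ n ≥ 1, 1 ≤ S n := by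
    intro S hS hS1 n hn
    induction n, hn using Nat.le_induction with
    | base => omega
    | succ k hk ih => rcases hS.2 k with h | h <;> omega
  have ha : 1 ≤ a N ∧ a N ≤ N := by
    by_contra hc
    have : μ {S | S N = a N} = 0 := by
      rw [measure_eq_zero_iff_ae_notMem]
      filter_upwards [hae, hae1] with S hS hS1 hSN
      apply hc
      rw [← show S N = a N from hSN]
      exact ⟨hge S hS hS1 N hN, hS.1 N⟩
    simp [pr, this] at hpos2
  have ht := (htrans N (a N) hN ha.1 ha.2 hpos2).2
  have hm := hM N (fun i => if i ≤ N then a i else N + 1)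
  have e1 : {S : Path | ∀ i ≤ N, S i = if i ≤ N then a i else N + 1} = {S | ∀ i ≤ N, S i = a i} := by
    ext S
    exact forall₂_congr fun i hi => by rw [if_pos hi]
  have e2 : {S : Path | (∀ i ≤ N, S i = if i ≤ N then a i else N + 1) ∧ S (N + 1) = N + 1}
      = {S | ∀ i ≤ N, S i = a i} ∩ jmp N := by
    rw [← e1]; rfl
  simp only [Nat.not_succ_le_self, le_refl, if_true, if_false] at hm
  rw [e1, e2] at hm
  have := hm hpos
  rw [ht, div_eq_iff hpos.ne'] at this
  exact this

theorem cyl_step2 [IsProbabilityMeasure μ] (h : ∀ (N : ℕ) (a : ℕ → ℕ),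
    pr μ ({S | ∀ i ≤ N, S i = a i} ∩ jmp N) =
      1 / ((N : ℝ) + 1) * pr μ {S | ∀ i ≤ N, S i = a i}) (N : ℕ)
    (T : Set ({i // i ≤ N} → ℕ)) :
    μ (rst N ⁻¹' T ∩ jmp N) =
      ENNReal.ofReal (1 / ((N : ℝ) + 1)) * μ (rst N ⁻¹' T) := by
  have hr : Measurable (rst N) :=
    measurable_pi_lambda _ fun i => measurable_pi_apply _
  have hT : MeasurableSet T := T.to_countable.measurableSet
  have key : (μ.restrict (jmp N)).map (rst N) =
      ENNReal.ofReal (1 / ((N : ℝ) + 1)) • μ.map (rst N) := by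
    apply Measure.ext_of_singleton
    intro b
    rw [Measure.smul_apply, Measure.map_apply hr (measurableSet_singleton _),
      Measure.map_apply hr (measurableSet_singleton _),
      Measure.restrict_apply (hr (measurableSet_singleton _))]
    have e : (rst N ⁻¹' {b}) =
        {S | ∀ i ≤ N, S i = if hi : i ≤ N then b ⟨i, hi⟩ else 0} := by
      ext S
      simp only [Set.mem_preimage, Set.mem_singleton_iff, funext_iff, Subtype.forall, rst,
        Set.mem_ofPred_eq]
      exact forall₂_congr fun i hi => by rw [dif_pos hi]
    rw [e]
    have := h N (fun i => if hi : i ≤ N then b ⟨i, hi⟩ else 0)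
    unfold pr at this
    rw [smul_eq_mul, ← ENNReal.toReal_eq_toReal_iff' (measure_ne_top _ _)
      (ENNReal.mul_ne_top ENNReal.ofReal_ne_top (measure_ne_top _ _)), this,
      ENNReal.toReal_mul, ENNReal.toReal_ofReal (by positivity)]
  have := congrArg (fun ν => ν T) key
  simpa only [Measure.smul_apply, Measure.map_apply hr hT, Measure.restrict_apply (hr hT),
    smul_eq_mul] using this

theorem jmp_indep [IsProbabilityMeasure μ] (h : ∀ (N : ℕ) (T : Set ({i // i ≤ N} → ℕ)),
    μ (rst N ⁻¹' T ∩ jmp N) =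
      ENNReal.ofReal (1 / ((N : ℝ) + 1)) * μ (rst N ⁻¹' T)) :
    ProbabilityTheory.iIndepSet jmp μ ∧ ∀ N, μ (jmp N) = ENNReal.ofReal (1 / ((N : ℝ) + 1)) := by
  have hp : ∀ N, μ (jmp N) = ENNReal.ofReal (1 / ((N : ℝ) + 1)) := fun N => by
    simpa using h N Set.univ
  refine ⟨?_, hp⟩
  rw [ProbabilityTheory.iIndepSet_iff_meas_biInter jmp_meas]
  intro s
  induction s using Finset.induction_on_max with
  | empty => simp
  | insert N s hs ih =>
    rw [Finset.prod_insert (fun hN => (hs N hN).false), ← ih, Finset.set_biInter_insert,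
      Set.inter_comm, hp]
    have e : (⋂ i ∈ s, jmp i) = rst N ⁻¹'
        {b : {i // i ≤ N} → ℕ | ∀ i, ∀ hi : i ∈ s, b ⟨i + 1, hs i hi⟩ = i + 1} := by
      ext S
      simp [jmp, rst]
    rw [e]
    exact h N _
end

theorem statement10 (μ : Measure Path) (hSMC : IsSMC μ)
    (h0 : pr μ {S | S 0 = 0} = 1) (h1 : pr μ {S | S 1 = 1} = 1)
    (htrans : ∀ N s : ℕ, 1 ≤ N → 1 ≤ s → s ≤ N → 0 < pr μ {S | S N = s} →
      pr μ {S | S N = s ∧ S (N + 1) = s} / pr μ {S | S N = s}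
          = (N : ℝ) / ((N : ℝ) + 1) ∧
      pr μ {S | S N = s ∧ S (N + 1) = N + 1} / pr μ {S | S N = s}
          = 1 / ((N : ℝ) + 1)) :
    μ {S : Path | Tendsto S atTop atTop} = 1 ∧ HasTrivialTail μ := by
  have hcyl := cyl_step hSMC h1 htrans
  obtain ⟨hp, hst, -⟩ := hSMC
  obtain ⟨hind, hj⟩ := jmp_indep (cyl_step2 hcyl)
  have hae : ∀ᵐ S ∂μ, S ∈ staircaseSet := by
    rw [← prob_compl_eq_zero_iff stair_meas] at hst
    exact hst
  have hinf : μ (limsup jmp atTop) = 1 := by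
    refine ProbabilityTheory.measure_limsup_eq_one jmp_meas hind ?_
    simp only [hj]
    by_contra hne
    have := ENNReal.summable_toReal hne
    refine Real.not_summable_one_div_natCast ((summable_nat_add_iff 1).1 ?_)
    refine this.congr fun n => ?_
    rw [ENNReal.toReal_ofReal (by positivity)]
    push_cast
    rfl
  have hinf' : ∀ᵐ S ∂μ, S ∈ inf0 := by
    rw [← prob_compl_eq_zero_iff (MeasurableSet.measurableSet_limsup jmp_meas)] at hinf
    have : ∀ᵐ S ∂μ, S ∈ limsup jmp atTop := hinf
    filter_upwards [this] with S hS
    rw [mem_limsup_iff_frequently_mem, frequently_atTop] at hS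
    exact hS
  constructor
  · have hT : ∀ᵐ S ∂μ, S ∈ {S : Path | Tendsto S atTop atTop} := by
      filter_upwards [hae, hinf'] with S a b
      exact stair_tendsto S a b
    exact (measure_congr (eventuallyEq_univ.2 hT)).trans measure_univ
  · intro A hA
    have e : μ A = μ (rec0 0 ⁻¹' A ∩ inf0) := by
      apply measure_congr
      rw [eventuallyEq_set]
      filter_upwards [hae, hinf'] with S a b
      exact (tail_eq2 A hA S a b).symm
    rw [e]
    refine ProbabilityTheory.measure_zero_or_one_of_measurableSet_limsup_atTop (s := sg) ?_ hind
      (tail_limsup A hA)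
    intro n
    exact MeasurableSpace.generateFrom_le fun t ht => by
      rw [Set.mem_singleton_iff.1 ht]; exact jmp_meas n

end VMCPaper
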